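/- Let Σ_p = (σ_ij) be a p×p covariance matrix with correlation matrix R_p = D_{Σ_p}^{−1/2} Σ_p D_{Σ_p}^{−1/2} = (ρ_ij), where D_{Σ_p} is the diagonal matrix of Σ_p, and suppose 1/κ ≤ σ_ii ≤ κ for all i and some constant κ > 0. Let Γ_p = G Σ_p G = (γ_ij), where G = I_p − p⁻¹ 1_p 1_pᵀ. Then γ_ij = σ_ij − σ_{i·} − σ_{j·} + σ_{··}, where σ_{i·} = p⁻¹ Σ_j σ_ij and σ_{··} = p⁻² Σ_{i,j} σ_ij, and max_{1≤i,j≤p} |γ_ij − σ_ij| ≤ 3κ ‖R_p‖₁ / p, where ‖R_p‖₁ = max_{1≤j≤p} Σ_{i=1}^p |ρ_ij|. -/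

import Mathlib

open MeasureTheory ProbabilityTheory Matrix Filter Topology Finset
open scoped Classical

noncomputable section

/-- The `p × p` centering matrix `G = I_p - p⁻¹ 1_p 1_pᵀ`. -/
def centeringMatrix (p : ℕ) : Matrix (Fin p) (Fin p) ℝ :=
  1 - ((p : ℝ)⁻¹) • Matrix.of (fun _ _ => (1 : ℝ))

/-- The cumulative distribution function of the standard normal distribution `N(0,1)`. -/
def stdNormalCDF (x : ℝ) : ℝ := ((gaussianReal 0 1) (Set.Iic x)).toReal

/-- The Gumbel-type cdf `F(x) = exp(-(1/√π) e^{-x/2})`. -/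
def gumbelCDF (x : ℝ) : ℝ := Real.exp (-(Real.sqrt Real.pi)⁻¹ * Real.exp (-x / 2))

/-- `X` is a Gaussian random vector with mean `m` and covariance matrix `Ψ` (characterized by the
fact that every linear functional of `X` is one-dimensional Gaussian with the induced mean and
variance). -/
def IsGaussianVec {Ω : Type*} [MeasurableSpace Ω] (μ : Measure Ω) {p : ℕ}
    (X : Ω → Fin p → ℝ) (m : Fin p → ℝ) (Ψ : Matrix (Fin p) (Fin p) ℝ) : Prop :=
  ∀ a : Fin p → ℝ,
    Measure.map (fun ω => a ⬝ᵥ X ω) μ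
      = gaussianReal (a ⬝ᵥ m) (Real.toNNReal (a ⬝ᵥ Ψ.mulVec a))

/-- The diagonal matrix `D_A` of a square matrix `A`. -/
def diagPart {p : ℕ} (A : Matrix (Fin p) (Fin p) ℝ) : Matrix (Fin p) (Fin p) ℝ :=
  Matrix.diagonal (fun i => A i i)

/-- The matrix `D_A⁻¹`, the inverse of the diagonal part of `A`. -/
def diagInv {p : ℕ} (A : Matrix (Fin p) (Fin p) ℝ) : Matrix (Fin p) (Fin p) ℝ :=
  Matrix.diagonal (fun i => (A i i)⁻¹)

/-- The matrix `D_A^{-1/2}`. -/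
def diagInvSqrt {p : ℕ} (A : Matrix (Fin p) (Fin p) ℝ) : Matrix (Fin p) (Fin p) ℝ :=
  Matrix.diagonal (fun i => (Real.sqrt (A i i))⁻¹)

/-- The correlation matrix `R = D_Σ^{-1/2} Σ D_Σ^{-1/2}` of a covariance matrix `Σ`. -/
def corrOf {p : ℕ} (S : Matrix (Fin p) (Fin p) ℝ) : Matrix (Fin p) (Fin p) ℝ :=
  diagInvSqrt S * S * diagInvSqrt S

/-- The maximum absolute column sum norm `‖A‖₁`. -/
def maxColSum {p : ℕ} (A : Matrix (Fin p) (Fin p) ℝ) : ℝ :=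
  ⨆ j : Fin p, ∑ i, |A i j|

/-- The largest eigenvalue of a matrix (as the supremum of its real spectrum). -/
def lambdaMax {p : ℕ} (A : Matrix (Fin p) (Fin p) ℝ) : ℝ := sSup (spectrum ℝ A)

/-- The smallest eigenvalue of a matrix (as the infimum of its real spectrum). -/
def lambdaMin {p : ℕ} (A : Matrix (Fin p) (Fin p) ℝ) : ℝ := sInf (spectrum ℝ A)

/-- The `i`-th largest eigenvalue of a symmetric real matrix (junk value `0` otherwise). -/
def nthEigDesc {p : ℕ} (A : Matrix (Fin p) (Fin p) ℝ) (i : Fin p) : ℝ :=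
  if hA : A.IsHermitian then (hA.eigenvalues ∘ Tuple.sort hA.eigenvalues) i.rev else 0

/-- The sample mean `Ȳ = n⁻¹ ∑ᵢ Yᵢ`. -/
def sampleMean {Ω : Type*} {p n : ℕ} (Y : Fin n → Ω → Fin p → ℝ) (ω : Ω) : Fin p → ℝ :=
  (n : ℝ)⁻¹ • ∑ i, Y i ω

/-- The sample covariance matrix `Γ̂ = n⁻¹ ∑ᵢ (Yᵢ - Ȳ)(Yᵢ - Ȳ)ᵀ`. -/
def sampleCov {Ω : Type*} {p n : ℕ} (Y : Fin n → Ω → Fin p → ℝ) (ω : Ω) :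
    Matrix (Fin p) (Fin p) ℝ :=
  (n : ℝ)⁻¹ • ∑ i, Matrix.vecMulVec (Y i ω - sampleMean Y ω) (Y i ω - sampleMean Y ω)

/-- The pooled two-sample covariance matrix. -/
def pooledCov {Ω : Type*} {p n1 n2 : ℕ}
    (Y1 : Fin n1 → Ω → Fin p → ℝ) (Y2 : Fin n2 → Ω → Fin p → ℝ) (ω : Ω) :
    Matrix (Fin p) (Fin p) ℝ :=
  ((n1 : ℝ) + n2)⁻¹ •
    (∑ i, Matrix.vecMulVec (Y1 i ω - sampleMean Y1 ω) (Y1 i ω - sampleMean Y1 ω)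
      + ∑ i, Matrix.vecMulVec (Y2 i ω - sampleMean Y2 ω) (Y2 i ω - sampleMean Y2 ω))

/-- The one-sample sum-type statistic `T_sum`. -/
def Tsum {Ω : Type*} {p n : ℕ} (Y : Fin n → Ω → Fin p → ℝ) (ω : Ω) : ℝ :=
  ((n : ℝ) * (sampleMean Y ω ⬝ᵥ (diagInv (sampleCov Y ω)).mulVec (sampleMean Y ω))
      - ((n : ℝ) - 1) * p / ((n : ℝ) - 3)) /
    Real.sqrt (2 *
      (Matrix.trace ((diagInvSqrt (sampleCov Y ω) * sampleCov Y ω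
          * diagInvSqrt (sampleCov Y ω)) ^ 2)
        - (p : ℝ) ^ 2 / ((n : ℝ) - 1)))

/-- The two-sample sum-type statistic `T_{sum,2}`. -/
def Tsum2 {Ω : Type*} {p n1 n2 : ℕ}
    (Y1 : Fin n1 → Ω → Fin p → ℝ) (Y2 : Fin n2 → Ω → Fin p → ℝ) (ω : Ω) : ℝ :=
  let d := sampleMean Y1 ω - sampleMean Y2 ω
  let C := pooledCov Y1 Y2 ω
  let t := Matrix.trace ((diagInvSqrt C * C * diagInvSqrt C) ^ 2)
  ((n1 : ℝ) * n2 / ((n1 : ℝ) + n2) * (d ⬝ᵥ (diagInv C).mulVec d)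
      - ((n1 : ℝ) + n2 - 2) * p / ((n1 : ℝ) + n2 - 4)) /
    Real.sqrt (2 * (t - (p : ℝ) ^ 2 / ((n1 : ℝ) + n2 - 2))
      * (1 + t / (p : ℝ) ^ ((3 : ℝ) / 2)))

/-- The one-sample max-type statistic `T_max`. -/
def Tmax {Ω : Type*} {p n : ℕ} (Y : Fin n → Ω → Fin p → ℝ) (ω : Ω) : ℝ :=
  (n : ℝ) * ⨆ i : Fin p, (sampleMean Y ω i) ^ 2 / sampleCov Y ω i i

/-- The two-sample max-type statistic `T_{max,2}`. -/
def Tmax2 {Ω : Type*} {p n1 n2 : ℕ}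
    (Y1 : Fin n1 → Ω → Fin p → ℝ) (Y2 : Fin n2 → Ω → Fin p → ℝ) (ω : Ω) : ℝ :=
  (n1 : ℝ) * n2 / ((n1 : ℝ) + n2) *
    ⨆ i : Fin p, (sampleMean Y1 ω i - sampleMean Y2 ω i) ^ 2 / pooledCov Y1 Y2 ω i i

/-- The centred log-ratio transformed sample `Yᵢ = G Lᵢ` built from log-basis vectors `Lᵢ`. -/
def clrSample {Ω : Type*} {p n : ℕ} (L : Fin n → Ω → Fin p → ℝ) :
    Fin n → Ω → Fin p → ℝ :=
  fun i ω => (centeringMatrix p).mulVec (L i ω)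

/-- `L₁, …, L_n` is an i.i.d. sample from the Gaussian distribution `N(m, S)`. -/
def IsIIDGaussianSample {Ω : Type*} [MeasurableSpace Ω] (μ : Measure Ω) {p n : ℕ}
    (L : Fin n → Ω → Fin p → ℝ) (m : Fin p → ℝ) (S : Matrix (Fin p) (Fin p) ℝ) : Prop :=
  (∀ i, Measurable (L i)) ∧ (∀ i, IsGaussianVec μ (L i) m S) ∧
    iIndepFun L μ

/-- The family `(U_k)` is i.i.d. with mean `0`, variance `1` and finite fourth moment `θ`. -/
def IsIIDWithMoments {Ω : Type*} [MeasurableSpace Ω] (μ : Measure Ω) {ι : Type*}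
    (U : ι → Ω → ℝ) (θ : ℝ) : Prop :=
  (∀ k, Measurable (U k)) ∧ iIndepFun U μ ∧
    ∃ ν : Measure ℝ, IsProbabilityMeasure ν ∧ (∀ k, Measure.map (U k) μ = ν) ∧
      (∫ x, x ∂ν) = 0 ∧ (∫ x, x ^ 2 ∂ν) = 1 ∧
      MeasureTheory.Integrable (fun x => x ^ 4) ν ∧ (∫ x, x ^ 4 ∂ν) = θ

/-- The population covariance matrix `Γ = G Σ G` of the centred log-ratio vectors. -/
def clrCov {p : ℕ} (S : Matrix (Fin p) (Fin p) ℝ) : Matrix (Fin p) (Fin p) ℝ :=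
  centeringMatrix p * S * centeringMatrix p

/-- `tr((D_A^{-1/2} A D_A^{-1/2})²)`. -/
def corrTraceSq {p : ℕ} (A : Matrix (Fin p) (Fin p) ℝ) : ℝ :=
  Matrix.trace ((diagInvSqrt A * A * diagInvSqrt A) ^ 2)

/-- The quadratic form `vᵀ A v`. -/
def quadForm {p : ℕ} (A : Matrix (Fin p) (Fin p) ℝ) (v : Fin p → ℝ) : ℝ :=
  v ⬝ᵥ A.mulVec v


/-- entries of `Γ = G Σ G` and the uniform bound `|γ_ij - σ_ij| ≤ 3κ‖R‖₁/p`. -/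
theorem centered_covariance_entries {p : ℕ} (hp : 0 < p)
    (S : Matrix (Fin p) (Fin p) ℝ) (hS : S.PosSemidef)
    (κ : ℝ) (hκ : 0 < κ) (hdiag : ∀ i, κ⁻¹ ≤ S i i ∧ S i i ≤ κ) :
    (∀ i j, (clrCov S) i j
        = S i j - (p : ℝ)⁻¹ * (∑ k, S i k) - (p : ℝ)⁻¹ * (∑ k, S j k)
          + ((p : ℝ)⁻¹) ^ 2 * (∑ k, ∑ l, S k l)) ∧
    (∀ i j, |(clrCov S) i j - S i j| ≤ 3 * κ * maxColSum (corrOf S) / (p : ℝ)) := by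
  have hsym : ∀ i j, S i j = S j i := fun i j => by
    have := hS.1.apply j i
    simpa using this
  have hp' : (0 : ℝ) < p := by exact_mod_cast hp
  have key : ∀ i j, (clrCov S) i j
        = S i j - (p : ℝ)⁻¹ * (∑ k, S i k) - (p : ℝ)⁻¹ * (∑ k, S j k)
          + ((p : ℝ)⁻¹) ^ 2 * (∑ k, ∑ l, S k l) := by
    intro i j
    have h1 : ∀ (A : Matrix (Fin p) (Fin p) ℝ) (a b : Fin p), (A * centeringMatrix p) a b
        = A a b - (p : ℝ)⁻¹ * ∑ k, A a k := by
      intro A a b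
      unfold centeringMatrix
      rw [Matrix.mul_sub, Matrix.mul_one, Matrix.sub_apply, Matrix.mul_smul, Matrix.smul_apply,
        Matrix.mul_apply]
      simp
    have h2 : ∀ (A : Matrix (Fin p) (Fin p) ℝ) (a b : Fin p), (centeringMatrix p * A) a b
        = A a b - (p : ℝ)⁻¹ * ∑ k, A k b := by
      intro A a b
      unfold centeringMatrix
      rw [Matrix.sub_mul, Matrix.one_mul, Matrix.sub_apply, Matrix.smul_mul, Matrix.smul_apply,
        Matrix.mul_apply]
      simp
    unfold clrCov
    rw [h1, h2]
    simp_rw [h2]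
    rw [Finset.sum_sub_distrib, ← Finset.mul_sum, Finset.sum_comm (f := fun x k => S k x)]
    simp_rw [fun k => hsym k j]
    ring
  refine ⟨key, fun i j => ?_⟩
  set M := maxColSum (corrOf S) with hM
  have hcol : ∀ j, ∑ k, |S j k| ≤ κ * M := by
    intro j
    have hle : ∑ k, |corrOf S k j| ≤ M :=
      le_ciSup (f := fun j => ∑ k, |corrOf S k j|) (Set.finite_range _).bddAbove j
    refine le_trans ?_ (mul_le_mul_of_nonneg_left hle hκ.le)
    rw [Finset.mul_sum]
    refine Finset.sum_le_sum fun k _ => ?_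
    have hpos : ∀ i, 0 < √(S i i) := fun i =>
      Real.sqrt_pos.2 (lt_of_lt_of_le (inv_pos.2 hκ) (hdiag i).1)
    have hR : corrOf S k j = (√(S k k))⁻¹ * S k j * (√(S j j))⁻¹ := by
      unfold corrOf diagInvSqrt
      rw [Matrix.mul_diagonal, Matrix.diagonal_mul]
    have hSR : S j k = (√(S k k) * √(S j j)) * corrOf S k j := by
      rw [hR, hsym j k]
      have := (hpos k).ne'
      have := (hpos j).ne'
      field_simp
    rw [hSR, abs_mul, abs_of_pos (mul_pos (hpos k) (hpos j))]
    refine mul_le_mul_of_nonneg_right ?_ (abs_nonneg _)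
    calc √(S k k) * √(S j j) ≤ √κ * √κ :=
          mul_le_mul (Real.sqrt_le_sqrt (hdiag k).2) (Real.sqrt_le_sqrt (hdiag j).2)
            (Real.sqrt_nonneg _) (Real.sqrt_nonneg _)
      _ = κ := Real.mul_self_sqrt hκ.le
  have hrow : ∀ j, |∑ k, S j k| ≤ κ * M := fun j =>
    (Finset.abs_sum_le_sum_abs _ _).trans (hcol j)
  have htot : |∑ k, ∑ l, S k l| ≤ p * (κ * M) := by
    refine (Finset.abs_sum_le_sum_abs _ _).trans ?_
    refine (Finset.sum_le_sum fun k _ => hrow k).trans ?_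
    simp
  have h3 : |(p : ℝ)⁻¹ * ∑ k, ∑ l, S k l| ≤ κ * M := by
    rw [abs_mul, abs_of_pos (inv_pos.2 hp'), inv_mul_le_iff₀ hp']
    exact htot
  have e : clrCov S i j - S i j
      = (-(∑ k, S i k) - (∑ k, S j k) + (p : ℝ)⁻¹ * ∑ k, ∑ l, S k l) / p := by
    rw [key]
    ring
  rw [e, abs_div, abs_of_pos hp']
  refine div_le_div_of_nonneg_right ?_ hp'.le
  have a1 := abs_le.1 (hrow i)
  have a2 := abs_le.1 (hrow j)
  have a3 := abs_le.1 h3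
  rw [abs_le]
  constructor <;> linarith [a1.1, a1.2, a2.1, a2.2, a3.1, a3.2]

end
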